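/- Let C ⊆ Z_2^α × R^β be a Z_2R linear code with α > 0 and β > 0 such that (1,…,1 | 0,…,0) ∈ C and (0,…,0 | u,…,u) ∈ C, the set of Lee weights of nonzero codewords of C has exactly two elements, and α = 2β. Then C is self-dual if and only if either: (i) (α, β) = (2, 1) and C is the R-submodule of Z_2^2 × R generated by (1, 1 | 0) and (0, 0 | u); or (ii) (α, β) = (4, 2) and there exist a permutation σ of the 4 binary coordinates and a permutation τ of the 2 R-coordinates such that the image of C under the induced coordinate permutation of Z_2^4 × R^2 equals the R-submodule generated by (1, 1, 1, 1 | 0, 0), (0, 1, 0, 1 | 0, u) and (0, 0, 1, 1 | 1, 1). -/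

import Mathlib

open Finset

namespace Z2R

abbrev Rng : Type := DualNumber (ZMod 2)
noncomputable instance : DecidableEq Rng := Classical.decEq _
def uu : Rng := DualNumber.eps
abbrev Amb (α β : ℕ) : Type := (Fin α → ZMod 2) × (Fin β → Rng)
def smulR {α β : ℕ} (d : Rng) (x : Amb α β) : Amb α β :=
  (fun i => d.fst * x.1 i, fun j => d * x.2 j)
def IsCode {α β : ℕ} (C : Set (Amb α β)) : Prop :=
  (0 : Amb α β) ∈ C ∧ (∀ x ∈ C, ∀ y ∈ C, x + y ∈ C) ∧ ∀ (d : Rng), ∀ x ∈ C, smulR d x ∈ C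
def inn {α β : ℕ} (v w : Amb α β) : Rng :=
  TrivSqZeroExt.inr (∑ i, v.1 i * w.1 i) + ∑ j, v.2 j * w.2 j
def dual {α β : ℕ} (C : Set (Amb α β)) : Set (Amb α β) :=
  {w | ∀ v ∈ C, inn v w = 0}
def IsSelfDual {α β : ℕ} (C : Set (Amb α β)) : Prop :=
  IsCode C ∧ C = dual C
def wtH {n : ℕ} (v : Fin n → ZMod 2) : ℕ := (univ.filter fun i => v i ≠ 0).card
noncomputable def wtLr (r : Rng) : ℕ := if r = 0 then 0 else if r = uu then 2 else 1
noncomputable def wtL {α β : ℕ} (c : Amb α β) : ℕ := wtH c.1 + ∑ j, wtLr (c.2 j)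
noncomputable def N {β : ℕ} (w : Fin β → Rng) : ℕ :=
  (univ.filter fun j => w j = 1 ∨ w j = 1 + uu).card
noncomputable def Nu {β : ℕ} (w : Fin β → Rng) : ℕ :=
  (univ.filter fun j => w j = uu).card
noncomputable def Ns {β : ℕ} (w y : Fin β → Rng) : ℕ :=
  (univ.filter fun j => w j = y j ∧ (w j = 1 ∨ w j = 1 + uu)).card
noncomputable def Nd {β : ℕ} (w y : Fin β → Rng) : ℕ :=
  (univ.filter fun j => (w j = 1 ∧ y j = 1 + uu) ∨ (w j = 1 + uu ∧ y j = 1)).card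
noncomputable def N11 {β : ℕ} (w y : Fin β → Rng) : ℕ :=
  (univ.filter fun j => (w j = 1 ∨ w j = 1 + uu) ∧ (y j = 1 ∨ y j = 1 + uu)).card
def CX {α β : ℕ} (C : Set (Amb α β)) : Set (Fin α → ZMod 2) := Prod.fst '' C
def CY {α β : ℕ} (C : Set (Amb α β)) : Set (Fin β → Rng) := Prod.snd '' C
def Separable {α β : ℕ} (C : Set (Amb α β)) : Prop := C = (CX C) ×ˢ (CY C)
def Cb {α β : ℕ} (C : Set (Amb α β)) : Set (Amb α β) :=
  {c ∈ C | ∀ j, c.2 j = 0 ∨ c.2 j = uu}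
def lincomb {α β k : ℕ} (g : Fin k → Amb α β) : Set (Amb α β) :=
  {z | ∃ a : Fin k → Rng, z = ∑ i, smulR (a i) (g i)}
noncomputable def theta (r : Rng) : ZMod 4 :=
  if r = 0 then 0 else if r = 1 then 1 else if r = uu then 2 else 3

lemma inn_comm {α β : ℕ} (v w : Amb α β) : inn v w = inn w v := by
  simp only [inn, mul_comm]

lemma inn_add_left {α β : ℕ} (x y w : Amb α β) : inn (x + y) w = inn x w + inn y w := by
  simp only [inn, Prod.fst_add, Prod.snd_add, Pi.add_apply, add_mul, sum_add_distrib,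
    TrivSqZeroExt.inr_add]
  abel

lemma inn_smulR_left {α β : ℕ} (d : Rng) (x w : Amb α β) :
    inn (smulR d x) w = d * inn x w := by
  have h : d * TrivSqZeroExt.inr (∑ i, x.1 i * w.1 i)
      = TrivSqZeroExt.inr (d.fst * ∑ i, x.1 i * w.1 i) := by
    ext <;> simp [mul_comm]
  simp only [inn, smulR, mul_add, h, mul_sum, mul_assoc]

lemma inn_zero_left {α β : ℕ} (w : Amb α β) : inn 0 w = 0 := by
  simp [inn]

lemma isCode_dual {α β : ℕ} (S : Set (Amb α β)) : IsCode (dual S) := by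
  refine ⟨fun v _ => ?_, fun x hx y hy v hv => ?_, fun d x hx v hv => ?_⟩
  · rw [inn_comm, inn_zero_left]
  · rw [inn_comm, inn_add_left, inn_comm x, inn_comm y, hx v hv, hy v hv, add_zero]
  · rw [inn_comm, inn_smulR_left, inn_comm x, hx v hv, mul_zero]

lemma lincomb_subset {α β k : ℕ} {C : Set (Amb α β)} (hC : IsCode C) {g : Fin k → Amb α β}
    (hg : ∀ i, g i ∈ C) : lincomb g ⊆ C := by
  rintro _ ⟨a, rfl⟩
  exact sum_induction _ (· ∈ C) (fun x y hx hy => hC.2.1 x hx y hy) hC.1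
    fun i _ => hC.2.2 _ _ (hg i)

lemma gen_mem_lincomb {α β k : ℕ} (g : Fin k → Amb α β) (i : Fin k) : g i ∈ lincomb g := by
  refine ⟨Pi.single i 1, ?_⟩
  rw [sum_eq_single i]
  · ext <;> simp [smulR]
  · intro j _ hj
    ext <;> simp [smulR, Pi.single_eq_of_ne hj]
  · simp

lemma dual_anti {α β : ℕ} {S T : Set (Amb α β)} (h : S ⊆ T) : dual T ⊆ dual S :=
  fun _ hw v hv => hw v (h hv)

lemma lincomb_subset_dual {α β k : ℕ} {g : Fin k → Amb α β}
    (hg : ∀ i j, inn (g i) (g j) = 0) : lincomb g ⊆ dual (lincomb g) := by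
  refine lincomb_subset (isCode_dual _) fun i v hv => ?_
  have h : lincomb g ⊆ dual {g i} := by
    refine lincomb_subset (isCode_dual _) fun j w hw => ?_
    rw [Set.mem_singleton_iff.1 hw]
    exact hg i j
  rw [inn_comm]
  exact h hv (g i) rfl

/-- Reindexing of both blocks of coordinates. -/
def reindex {α β a b : ℕ} (e : Fin a ≃ Fin α) (f : Fin b ≃ Fin β) (c : Amb α β) : Amb a b :=
  (fun i => c.1 (e i), fun j => c.2 (f j))

lemma inn_reindex {α β a b : ℕ} (e : Fin a ≃ Fin α) (f : Fin b ≃ Fin β) (v w : Amb α β) :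
    inn (reindex e f v) (reindex e f w) = inn v w := by
  simp only [inn, reindex]
  rw [e.sum_comp fun i => v.1 i * w.1 i, f.sum_comp fun i => v.2 i * w.2 i]

lemma reindex_injective {α β a b : ℕ} (e : Fin a ≃ Fin α) (f : Fin b ≃ Fin β) :
    Function.Injective (reindex e f) := by
  intro x y h
  refine Prod.ext (funext fun i => ?_) (funext fun j => ?_)
  · simpa [reindex] using congrFun (congrArg Prod.fst h) (e.symm i)
  · simpa [reindex] using congrFun (congrArg Prod.snd h) (f.symm j)

lemma reindex_surjective {α β a b : ℕ} (e : Fin a ≃ Fin α) (f : Fin b ≃ Fin β) :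
    Function.Surjective (reindex e f) := fun y =>
  ⟨(fun i => y.1 (e.symm i), fun j => y.2 (f.symm j)), by simp [reindex]⟩

lemma dual_image_reindex {α β a b : ℕ} (e : Fin a ≃ Fin α) (f : Fin b ≃ Fin β)
    (C : Set (Amb α β)) : dual (reindex e f '' C) = reindex e f '' dual C := by
  ext y
  obtain ⟨x, rfl⟩ := reindex_surjective e f y
  rw [(reindex_injective e f).mem_set_image]
  simp only [dual, Set.mem_ofPred_eq, Set.forall_mem_image, inn_reindex]

lemma isCode_image_reindex {α β a b : ℕ} (e : Fin a ≃ Fin α) (f : Fin b ≃ Fin β)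
    {C : Set (Amb α β)} (hC : IsCode C) : IsCode (reindex e f '' C) := by
  refine ⟨⟨0, hC.1, rfl⟩, ?_, ?_⟩
  · rintro _ ⟨x, hx, rfl⟩ _ ⟨y, hy, rfl⟩
    exact ⟨x + y, hC.2.1 x hx y hy, rfl⟩
  · rintro d _ ⟨x, hx, rfl⟩
    exact ⟨smulR d x, hC.2.2 d x hx, rfl⟩

/-- The reindexing of a self-dual code equals any self-dual code whose generators it contains. -/
lemma image_reindex_eq_lincomb {α β a b k : ℕ} (e : Fin a ≃ Fin α) (f : Fin b ≃ Fin β)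
    {C : Set (Amb α β)} (hC : IsCode C) (hd : C = dual C) {g : Fin k → Amb a b}
    (hg : ∀ i, g i ∈ reindex e f '' C) (hgd : lincomb g = dual (lincomb g)) :
    reindex e f '' C = lincomb g := by
  have hsub := lincomb_subset (isCode_image_reindex e f hC) hg
  refine Set.Subset.antisymm ?_ hsub
  rw [hgd]
  conv_lhs => rw [hd, ← dual_image_reindex]
  exact dual_anti hsub

lemma eq_dual_of_image_reindex {α β a b k : ℕ} (e : Fin a ≃ Fin α) (f : Fin b ≃ Fin β)
    {C : Set (Amb α β)} {g : Fin k → Amb a b} (h : reindex e f '' C = lincomb g)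
    (hgd : lincomb g = dual (lincomb g)) : C = dual C := by
  apply (reindex_injective e f).image_injective
  rw [← dual_image_reindex, h]
  exact hgd

lemma fst_uu : uu.fst = 0 := rfl

lemma snd_uu : uu.snd = 1 := rfl

lemma zmod_two_eq (x : ZMod 2) : x = 0 ∨ x = 1 := by
  revert x; decide

lemma rng_cases (r : Rng) : r = 0 ∨ r = 1 ∨ r = uu ∨ r = 1 + uu := by
  rcases zmod_two_eq r.fst with h | h <;> rcases zmod_two_eq r.snd with h' | h'
  · exact Or.inl (TrivSqZeroExt.ext h h')
  · exact Or.inr (Or.inr (Or.inl (TrivSqZeroExt.ext h h')))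
  · exact Or.inr (Or.inl (TrivSqZeroExt.ext h h'))
  · refine Or.inr (Or.inr (Or.inr (TrivSqZeroExt.ext ?_ ?_)))
    · simp [h, fst_uu]
    · simp [h', snd_uu]

lemma uu_ne_zero : uu ≠ 0 := fun h => by
  simpa [snd_uu] using congrArg TrivSqZeroExt.snd h

lemma wtLr_zero : wtLr 0 = 0 := by simp [wtLr]

lemma wtLr_uu : wtLr uu = 2 := by simp [wtLr, uu_ne_zero]

lemma wtLr_of_fst_ne_zero {r : Rng} (h : r.fst ≠ 0) : wtLr r = 1 := by
  have h0 : r ≠ 0 := by rintro rfl; simp at h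
  have h1 : r ≠ uu := by rintro rfl; simp [fst_uu] at h
  simp [wtLr, h0, h1]

lemma wtH_zero {n : ℕ} : wtH (0 : Fin n → ZMod 2) = 0 := by simp [wtH]

/-- The self-dual code of type `(2, 1)`. -/
lemma lincomb_two_one_self_dual :
    lincomb ![((![1, 1] : Fin 2 → ZMod 2), (![0] : Fin 1 → Rng)), (![0, 0], ![uu])]
      = dual (lincomb ![((![1, 1] : Fin 2 → ZMod 2), (![0] : Fin 1 → Rng)),
          (![0, 0], ![uu])]) := by
  set g := ![((![1, 1] : Fin 2 → ZMod 2), (![0] : Fin 1 → Rng)), (![0, 0], ![uu])] with hg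
  refine Set.Subset.antisymm (lincomb_subset_dual fun i j => ?_) fun w hw => ?_
  · fin_cases i <;> fin_cases j <;> ext <;> simp [hg, inn, fst_uu, snd_uu] <;> decide
  · have e0 := congrArg TrivSqZeroExt.snd (hw _ (gen_mem_lincomb g 0))
    have e1 := congrArg TrivSqZeroExt.snd (hw _ (gen_mem_lincomb g 1))
    simp [hg, inn, fst_uu, snd_uu, Fin.sum_univ_two] at e0 e1
    obtain ⟨v, y⟩ := w
    refine ⟨![TrivSqZeroExt.inl (v 0), TrivSqZeroExt.inl (y 0).snd], ?_⟩
    refine Prod.ext (funext fun i => ?_) (funext fun j => TrivSqZeroExt.ext ?_ ?_)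
    · simp only at e0
      have : v 0 = v 1 := by
        generalize v 0 = a at *; generalize v 1 = b at *; revert a b; decide
      fin_cases i <;> simp [hg, smulR, this]
    · fin_cases j
      simp [hg, smulR, fst_uu, e1]
    · fin_cases j
      simp [hg, smulR, snd_uu]

/-- The self-dual code of type `(4, 2)`. -/
lemma lincomb_four_two_self_dual :
    lincomb ![((![1, 1, 1, 1] : Fin 4 → ZMod 2), (![0, 0] : Fin 2 → Rng)),
        (![0, 1, 0, 1], ![0, uu]), (![0, 0, 1, 1], ![1, 1])]
      = dual (lincomb ![((![1, 1, 1, 1] : Fin 4 → ZMod 2), (![0, 0] : Fin 2 → Rng)),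
          (![0, 1, 0, 1], ![0, uu]), (![0, 0, 1, 1], ![1, 1])]) := by
  set g := ![((![1, 1, 1, 1] : Fin 4 → ZMod 2), (![0, 0] : Fin 2 → Rng)),
    (![0, 1, 0, 1], ![0, uu]), (![0, 0, 1, 1], ![1, 1])] with hg
  refine Set.Subset.antisymm (lincomb_subset_dual fun i j => ?_) fun w hw => ?_
  · fin_cases i <;> fin_cases j <;> ext <;>
      simp [hg, inn, fst_uu, snd_uu, Fin.sum_univ_four, Fin.sum_univ_two] <;> decide
  · have e0 := congrArg TrivSqZeroExt.snd (hw _ (gen_mem_lincomb g 0))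
    have e1 := congrArg TrivSqZeroExt.snd (hw _ (gen_mem_lincomb g 1))
    have e2 := congrArg TrivSqZeroExt.snd (hw _ (gen_mem_lincomb g 2))
    have e3 := congrArg TrivSqZeroExt.fst (hw _ (gen_mem_lincomb g 2))
    simp [hg, inn, fst_uu, snd_uu, Fin.sum_univ_two, Fin.sum_univ_four] at e0 e1 e2 e3
    obtain ⟨v, y⟩ := w
    simp only at e0 e1 e2 e3
    refine ⟨![TrivSqZeroExt.inl (v 0), TrivSqZeroExt.inl (v 0 + v 1), y 0], ?_⟩
    generalize h0 : v 0 = a0 at *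
    generalize h1 : v 1 = a1 at *
    generalize h2 : v 2 = a2 at *
    generalize h3 : v 3 = a3 at *
    generalize h4 : (y 0).fst = b0 at *
    generalize h5 : (y 0).snd = c0 at *
    generalize h6 : (y 1).fst = b1 at *
    generalize h7 : (y 1).snd = c1 at *
    refine Prod.ext (funext fun i => ?_) (funext fun j => TrivSqZeroExt.ext ?_ ?_)
    · fin_cases i <;> simp [smulR, Fin.sum_univ_three, *] <;>
        clear * - e0 e1 e2 e3
      all_goals
        revert e0 e1 e2 e3
        revert a0 a1 a2 a3 b0 b1 c0 c1
        decide
    · fin_cases j <;> simp [smulR, Fin.sum_univ_three, fst_uu, *] <;>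
        clear * - e0 e1 e2 e3
      all_goals
        revert e0 e1 e2 e3
        revert a0 a1 a2 a3 b0 b1 c0 c1
        decide
    · fin_cases j <;> simp [smulR, Fin.sum_univ_three, fst_uu, snd_uu, *] <;>
        clear * - e0 e1 e2 e3
      all_goals
        revert e0 e1 e2 e3
        revert a0 a1 a2 a3 b0 b1 c0 c1
        decide

/-- Two binary words of length four and weight two that meet in exactly one place. -/
lemma exists_perm_of_wtH_eq_two (v x : Fin 4 → ZMod 2) (hv : wtH v = 2) (hx : wtH x = 2)
    (hvx : ∑ i, x i * v i = 1) :
    ∃ σ : Equiv.Perm (Fin 4), (fun i => v (σ i)) = ![0, 0, 1, 1] ∧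
      (fun i => x (σ i)) = ![0, 1, 0, 1] := by
  have hinj : Function.Injective fun i : Fin 4 =>
      (⟨2 * (v i).val + (x i).val, by have := (v i).val_lt; have := (x i).val_lt; omega⟩ :
        Fin 4) := by
    revert v x
    decide
  let σ := (Equiv.ofBijective _ hinj.bijective_of_finite).symm
  have hσ (i : Fin 4) : 2 * (v (σ i)).val + (x (σ i)).val = i.val :=
    congrArg Fin.val ((Equiv.ofBijective _ hinj.bijective_of_finite).apply_symm_apply i)
  have hsplit : ∀ a b : ZMod 2, ∀ i : Fin 4, 2 * a.val + b.val = i.val →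
      a = ![0, 0, 1, 1] i ∧ b = ![0, 1, 0, 1] i := by
    decide
  exact ⟨σ, funext fun i => (hsplit _ _ i (hσ i)).1, funext fun i => (hsplit _ _ i (hσ i)).2⟩

lemma wtLr_uu_mul (r : Rng) : wtLr (uu * r) = if r.fst = 0 then 0 else 2 := by
  rcases zmod_two_eq r.fst with h | h
  · have : uu * r = 0 := by ext <;> simp [fst_uu, snd_uu, h]
    simp [this, h, wtLr_zero]
  · have : uu * r = uu := by ext <;> simp [fst_uu, snd_uu, h]
    simp [this, h, wtLr_uu]

/-- In a two-weight code containing `(1 | 0)` and `(0 | u)`, the weights are `2β` and `4β`. -/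
lemma wtL_eq_of_two_weight {α β : ℕ} (hβ : 0 < β) {C : Set (Amb α β)} (hC : IsCode C)
    (h1 : ((fun _ => 1, fun _ => 0) : Amb α β) ∈ C)
    (h2 : ((fun _ => 0, fun _ => uu) : Amb α β) ∈ C)
    (htw : (wtL '' (C \ {0})).ncard = 2) (hab : α = 2 * β) {c : Amb α β} (hc : c ∈ C)
    (h0 : c ≠ 0) : wtL c = 2 * β ∨ wtL c = 4 * β := by
  have hw2 : wtL ((fun _ => 0, fun _ => uu) : Amb α β) = 2 * β := by
    simp [wtL, wtH, wtLr_uu, mul_comm]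
  have hw3 : wtL ((fun _ => 1, fun _ => uu) : Amb α β) = 4 * β := by
    simp [wtL, wtH, wtLr_uu]
    omega
  have h3 : ((fun _ => 1, fun _ => uu) : Amb α β) ∈ C := by
    have := hC.2.1 _ h1 _ h2
    rwa [show ((fun _ => 1, fun _ => 0) : Amb α β) + (fun _ => 0, fun _ => uu)
      = (fun _ => 1, fun _ => uu) by ext <;> simp] at this
  have hne (v : Fin α → ZMod 2) : ((v, fun _ => uu) : Amb α β) ≠ 0 := fun h =>
    uu_ne_zero (congrFun (congrArg Prod.snd h) ⟨0, hβ⟩)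
  have hsub : ({2 * β, 4 * β} : Set ℕ) ⊆ wtL '' (C \ {0}) := by
    rintro _ (rfl | rfl)
    · exact ⟨_, ⟨h2, hne _⟩, hw2⟩
    · exact ⟨_, ⟨h3, hne _⟩, hw3⟩
  have heq := Set.eq_of_subset_of_ncard_le hsub
    (by rw [htw, Set.ncard_pair (by omega)]) (Set.finite_of_ncard_ne_zero (by omega))
  have : wtL c ∈ wtL '' (C \ {0}) := ⟨c, ⟨hc, h0⟩, rfl⟩
  rw [← heq] at this
  exact this

/-- Multiplying a codeword by `u` shows that its `R`-entries are all units or all non-units. -/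
lemma fst_eq_fst_of_weights {α β : ℕ} {C : Set (Amb α β)} (hC : IsCode C)
    (hw : ∀ c ∈ C, c ≠ 0 → 2 * β ≤ wtL c) {c : Amb α β} (hc : c ∈ C) (i j : Fin β) :
    (c.2 i).fst = (c.2 j).fst := by
  have key (k l : Fin β) (hk : (c.2 k).fst ≠ 0) : (c.2 l).fst ≠ 0 := by
    intro hl
    have hwt : wtL (smulR uu c) = ∑ j, if (c.2 j).fst = 0 then 0 else 2 := by
      simp [wtL, smulR, wtH, fst_uu, wtLr_uu_mul]
    have hne : smulR uu c ≠ 0 := by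
      intro h
      have := congrArg TrivSqZeroExt.snd (congrFun (congrArg Prod.snd h) k)
      simp [smulR, fst_uu, snd_uu, hk] at this
    have hlt : ∑ j, (if (c.2 j).fst = 0 then 0 else 2) < ∑ _j : Fin β, 2 :=
      sum_lt_sum (fun j _ => by split_ifs <;> omega) ⟨l, mem_univ _, by simp [hl]⟩
    have := hw _ (hC.2.2 uu c hc) hne
    simp only [sum_const, card_univ, Fintype.card_fin, smul_eq_mul] at hlt
    omega
  have h1 := key i j
  have h2 := key j i
  generalize (c.2 i).fst = a at *
  generalize (c.2 j).fst = b at *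
  rcases zmod_two_eq a with rfl | rfl <;> rcases zmod_two_eq b with rfl | rfl <;> simp_all

/-- Since `(0 | u, u, 0, …, 0)` is orthogonal to the code, it is a codeword of weight four. -/
lemma le_two_of_self_dual {α β : ℕ} {C : Set (Amb α β)} (hC : IsCode C)
    (hw : ∀ c ∈ C, c ≠ 0 → 2 * β ≤ wtL c) (hd : C = dual C) : β ≤ 2 := by
  by_contra! hβ
  let i : Fin β := ⟨0, by omega⟩
  let j : Fin β := ⟨1, by omega⟩
  have hij : i ≠ j := by simp [i, j]
  let e : Amb α β := (0, fun k => if k = i then uu else if k = j then uu else 0)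
  have hmem : e ∈ C := by
    rw [hd]
    intro c hc
    have hf := fst_eq_fst_of_weights hC hw hc i j
    have hs (k : Fin β) : c.2 k * e.2 k
        = (if k = i then c.2 i * uu else 0) + (if k = j then c.2 j * uu else 0) := by
      by_cases hki : k = i
      · subst hki
        simp [e, hij]
      · by_cases hkj : k = j
        · subst hkj
          simp [e, hij.symm]
        · simp [e, hki, hkj]
    simp only [inn, hs, sum_add_distrib]
    ext <;> simp [e, fst_uu, snd_uu, hf, CharTwo.add_self_eq_zero]
  have hne : e ≠ 0 := fun h => uu_ne_zero <| by
    simpa [e] using congrFun (congrArg Prod.snd h) i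
  have hwt : wtL e = 4 := by
    have hs (k : Fin β) : wtLr (e.2 k) = (if k = i then 2 else 0) + (if k = j then 2 else 0) := by
      by_cases hki : k = i
      · subst hki
        simp [e, hij, wtLr_uu]
      · by_cases hkj : k = j
        · subst hkj
          simp [e, hij.symm, wtLr_uu]
        · simp [e, hki, hkj, wtLr_zero]
    simp only [wtL, hs, sum_add_distrib]
    simp [e, wtH_zero]
  have := hw e hmem hne
  omega

lemma wtL_four_two (c : Amb 4 2) : wtL c = wtH c.1 + (wtLr (c.2 0) + wtLr (c.2 1)) := by
  simp [wtL, Fin.sum_univ_two]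

lemma wtH_le {n : ℕ} (v : Fin n → ZMod 2) : wtH v ≤ n := by
  simpa [wtH] using card_le_univ (univ.filter fun i => v i ≠ 0)

lemma exists_odd_meet (v : Fin 4 → ZMod 2) (hv : wtH v = 2) :
    ∃ x : Fin 4 → ZMod 2, wtH x = 2 ∧ ∑ i, v i * x i = 1 := by
  revert v
  decide

lemma sum_mul_eq_zero (y x : Fin 4 → ZMod 2) (hy : wtH y = 0 ∨ wtH y = 4) (hx : wtH x = 2) :
    ∑ i, y i * x i = 0 := by
  revert y x
  decide

/-- Generators of a self-dual two-weight code of type `(4, 2)`. -/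
lemma exists_generators {C : Set (Amb 4 2)} (hC : IsCode C) (hd : C = dual C)
    (hw : ∀ c ∈ C, c ≠ 0 → wtL c = 4 ∨ wtL c = 8) :
    ∃ v x : Fin 4 → ZMod 2, wtH v = 2 ∧ wtH x = 2 ∧ ∑ i, x i * v i = 1 ∧
      ((v, ![1, 1]) : Amb 4 2) ∈ C ∧ ((x, ![0, uu]) : Amb 4 2) ∈ C := by
  have horth {c d : Amb 4 2} (hc : c ∈ C) (hd' : d ∈ C) : inn c d = 0 := by
    rw [hd] at hd'
    exact hd' c hc
  have hpar {c : Amb 4 2} (hc : c ∈ C) : (c.2 0).fst = (c.2 1).fst :=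
    fst_eq_fst_of_weights hC (fun c hc h => by have := hw c hc h; omega) hc 0 1
  have hunit {c : Amb 4 2} (hc : c ∈ C) (h : c.2 0 = 1) : wtH c.1 = 2 := by
    have hf : (c.2 1).fst = 1 := by rw [← hpar hc, h]; rfl
    have hwt := hw c hc fun h0 => by simp [h0] at h
    rw [wtL_four_two, h, wtLr_of_fst_ne_zero (r := 1) (by simp),
      wtLr_of_fst_ne_zero (r := c.2 1) (by simp [hf])] at hwt
    have := wtH_le c.1
    omega
  obtain ⟨c, hc, hc0⟩ : ∃ c ∈ C, c.2 0 = 1 := by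
    have hnot : ((0, ![uu, 0]) : Amb 4 2) ∉ C := fun h => by
      have hwt := hw _ h fun h0 => uu_ne_zero (by
        simpa using congrFun (congrArg Prod.snd h0) 0)
      simp [wtL_four_two, wtH_zero, wtLr_zero, wtLr_uu] at hwt
    rw [hd] at hnot
    simp only [dual, Set.mem_ofPred_eq, not_forall] at hnot
    obtain ⟨c, hc, hne⟩ := hnot
    refine ⟨smulR (c.2 0) c, hC.2.2 _ c hc, ?_⟩
    have hf : (c.2 0).fst = 1 := by
      rcases zmod_two_eq (c.2 0).fst with h | h
      · exact absurd (by ext <;> simp [inn, fst_uu, snd_uu, h, Fin.sum_univ_two]) hne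
      · exact h
    ext <;> simp [smulR, hf, CharTwo.add_self_eq_zero]
  obtain ⟨d, hdC, hd0, hd1⟩ : ∃ d ∈ C, d.2 0 = 0 ∧ d.2 1 = uu := by
    by_contra! hno
    obtain ⟨x, hx, hcx⟩ := exists_odd_meet c.1 (hunit hc hc0)
    have hf : (c.2 1).fst = 1 := by rw [← hpar hc, hc0]; rfl
    have hce : inn c (x, ![0, uu]) = 0 := by
      ext <;> simp [inn, fst_uu, snd_uu, hcx, hf, Fin.sum_univ_two, CharTwo.add_self_eq_zero]
    refine hno (x, ![0, uu]) ?_ rfl rfl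
    rw [hd]
    intro z hz
    have hyC : z + smulR (z.2 0) c ∈ C := hC.2.1 _ hz _ (hC.2.2 _ _ hc)
    have hz_eq : inn z (x, ![0, uu]) = inn (z + smulR (z.2 0) c) (x, ![0, uu]) := by
      rw [inn_add_left, inn_smulR_left, hce, mul_zero, add_zero]
    have hy0 : (z + smulR (z.2 0) c).2 0 = 0 := by
      ext <;> simp [smulR, hc0, CharTwo.add_self_eq_zero]
    rw [hz_eq]
    generalize z + smulR (z.2 0) c = y at *
    have hy1 : y.2 1 = 0 := by
      have hf := hpar hyC
      rw [hy0] at hf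
      rcases rng_cases (y.2 1) with h | h | h | h
      · exact h
      · simp [h] at hf
      · exact absurd h (hno y hyC hy0)
      · simp [h, fst_uu] at hf
    have hyw : wtH y.1 = 0 ∨ wtH y.1 = 4 := by
      by_cases h : y = 0
      · exact Or.inl (by rw [h]; exact wtH_zero)
      · have hwt := hw y hyC h
        rw [wtL_four_two, hy0, hy1, wtLr_zero] at hwt
        have := wtH_le y.1
        omega
    simp [inn, hy0, hy1, sum_mul_eq_zero y.1 x hyw hx, Fin.sum_univ_two]
  obtain ⟨c, hc, hc0, hc1⟩ : ∃ c ∈ C, c.2 0 = 1 ∧ c.2 1 = 1 := by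
    have hf : (c.2 1).fst = 1 := by rw [← hpar hc, hc0]; rfl
    rcases rng_cases (c.2 1) with h | h | h | h
    · simp [h] at hf
    · exact ⟨c, hc, hc0, h⟩
    · simp [h, fst_uu] at hf
    · refine ⟨c + d, hC.2.1 _ hc _ hdC, by simp [hc0, hd0], ?_⟩
      ext <;> simp [h, hd1, fst_uu, snd_uu, CharTwo.add_self_eq_zero]
  refine ⟨c.1, d.1, hunit hc hc0, ?_, ?_, ?_, ?_⟩
  · have hwt := hw d hdC fun h => uu_ne_zero (by rw [← hd1, h]; rfl)
    rw [wtL_four_two, hd0, hd1, wtLr_zero, wtLr_uu] at hwt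
    have := wtH_le d.1
    omega
  · have h := congrArg TrivSqZeroExt.snd (horth hdC hc)
    simp only [inn, Fin.sum_univ_two, hd0, hd1, hc0, hc1] at h
    simp [snd_uu] at h
    rwa [CharTwo.add_eq_zero] at h
  · convert hc
    ext j : 1
    fin_cases j <;> simp [hc0, hc1]
  · convert hdC
    ext j : 1
    fin_cases j <;> simp [hd0, hd1]

-- STATEMENT 19
theorem stmt19 {α β : ℕ} (hα : 0 < α) (hβ : 0 < β) (C : Set (Amb α β)) (hcode : IsCode C)
    (h1 : ((fun _ => 1, fun _ => 0) : Amb α β) ∈ C)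
    (h2 : ((fun _ => 0, fun _ => uu) : Amb α β) ∈ C)
    (htw : (wtL '' (C \ {0})).ncard = 2) (hab : α = 2 * β) :
    C = dual C ↔
      ((∃ (ha : α = 2) (hb : β = 1),
          (fun c : Amb α β =>
              ((fun i => c.1 (Fin.cast ha.symm i), fun j => c.2 (Fin.cast hb.symm j)) :
                Amb 2 1)) '' C =
            lincomb ![((![1, 1] : Fin 2 → ZMod 2), (![0] : Fin 1 → Rng)),
              (![0, 0], ![uu])]) ∨
        (∃ (ha : α = 4) (hb : β = 2) (σ : Equiv.Perm (Fin 4)) (τ : Equiv.Perm (Fin 2)),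
          (fun c : Amb α β =>
              ((fun i => c.1 (Fin.cast ha.symm (σ i)), fun j => c.2 (Fin.cast hb.symm (τ j))) :
                Amb 4 2)) '' C =
            lincomb ![((![1, 1, 1, 1] : Fin 4 → ZMod 2), (![0, 0] : Fin 2 → Rng)),
              (![0, 1, 0, 1], ![0, uu]), (![0, 0, 1, 1], ![1, 1])])) := by
  have hw (c) (hc : c ∈ C) (h0 : c ≠ 0) : wtL c = 2 * β ∨ wtL c = 4 * β :=
    wtL_eq_of_two_weight hβ hcode h1 h2 htw hab hc h0
  constructor
  · intro hd
    have hle := le_two_of_self_dual hcode (fun c hc h0 => by have := hw c hc h0; omega) hd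
    obtain rfl | rfl : β = 1 ∨ β = 2 := by omega
    · obtain rfl : α = 2 := by omega
      refine Or.inl ⟨rfl, rfl, image_reindex_eq_lincomb (Equiv.refl _) (Equiv.refl _) hcode hd
        (fun i => ?_) lincomb_two_one_self_dual⟩
      fin_cases i
      · refine ⟨_, h1, ?_⟩
        ext i : 2 <;> fin_cases i <;> rfl
      · refine ⟨_, h2, ?_⟩
        ext i : 2 <;> fin_cases i <;> rfl
    · obtain rfl : α = 4 := by omega
      obtain ⟨v, x, hv, hx, hvx, hvC, hxC⟩ := exists_generators hcode hd hw
      obtain ⟨σ, hσv, hσx⟩ := exists_perm_of_wtH_eq_two v x hv hx hvx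
      refine Or.inr ⟨rfl, rfl, σ, 1, image_reindex_eq_lincomb σ 1 hcode hd
        (fun i => ?_) lincomb_four_two_self_dual⟩
      fin_cases i
      · refine ⟨_, h1, ?_⟩
        ext i : 2 <;> fin_cases i <;> rfl
      · exact ⟨_, hxC, Prod.ext hσx rfl⟩
      · exact ⟨_, hvC, Prod.ext hσv rfl⟩
  · rintro (⟨rfl, rfl, h⟩ | ⟨rfl, rfl, σ, τ, h⟩)
    · exact eq_dual_of_image_reindex (Equiv.refl _) (Equiv.refl _) h lincomb_two_one_self_dual
    · exact eq_dual_of_image_reindex σ τ h lincomb_four_two_self_dual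

end Z2R
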